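/- The partial derivative of T_{ii} with respect to λᵢ is nonnegative, where T = Λ Φ (ΦᵀΛΦ + δI_n)⁻¹ Φᵀ. Explicitly, ∂T_{ii}/∂λᵢ = (1 − λᵢ φᵢᵀ K⁻¹ φᵢ)(φᵢᵀ K⁻¹ φᵢ) ≥ 0, where φᵢᵀ is the i-th row of Φ and K = ΦᵀΛΦ + δI_n. -/

import Mathlib

open Matrix

theorem diagonal_mul_mul_mul_transpose_apply_self {m n R : Type*} [Fintype m] [Fintype n]
    [DecidableEq m] [CommSemiring R] (d : m → R) (Φ : Matrix m n R) (A : Matrix n n R) (i : m) :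
    (diagonal d * Φ * A * Φᵀ) i i = d i * (Φ i ⬝ᵥ (A *ᵥ Φ i)) := by
  rw [Matrix.mul_assoc, Matrix.mul_assoc, diagonal_mul]
  rfl

theorem transpose_mul_diagonal_update_mul {m n R : Type*} [Fintype m] [DecidableEq m]
    [CommRing R] (d : m → R) (Φ : Matrix m n R) (i : m) (t : R) :
    Φᵀ * diagonal (Function.update d i t) * Φ =
      Φᵀ * diagonal d * Φ + (t - d i) • vecMulVec (Φ i) (Φ i) := by
  have h : diagonal (Function.update d i t) = diagonal d + diagonal (Pi.single i (t - d i)) := by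
    rw [diagonal_add]
    congr 1
    ext j
    by_cases hj : j = i
    · subst hj; simp
    · simp [hj]
  rw [h, Matrix.mul_add, Matrix.add_mul]
  congr 1
  ext a b
  rw [mul_apply]
  simp only [mul_diagonal, transpose_apply, Matrix.smul_apply, vecMulVec_apply, smul_eq_mul]
  rw [Finset.sum_eq_single i]
  · rw [Pi.single_eq_same]; ring
  · intro j _ hj; simp [hj]
  · simp

theorem dotProduct_transpose_mul_diagonal_mul_add_smul_one_mulVec {m n R : Type*} [Fintype m]
    [Fintype n] [DecidableEq m] [DecidableEq n] [CommRing R] (d : m → R) (Φ : Matrix m n R)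
    (δ : R) (v : n → R) :
    v ⬝ᵥ ((Φᵀ * diagonal d * Φ + δ • (1 : Matrix n n R)) *ᵥ v) =
      ∑ j, d j * (Φ j ⬝ᵥ v) ^ 2 + δ * (v ⬝ᵥ v) := by
  rw [add_mulVec, dotProduct_add, smul_mulVec, one_mulVec, dotProduct_smul, smul_eq_mul,
    ← mulVec_mulVec, ← mulVec_mulVec, dotProduct_mulVec, vecMul_transpose]
  congr 1
  simp only [dotProduct, mulVec_diagonal]
  refine Finset.sum_congr rfl fun j _ => ?_
  simp only [mulVec, dotProduct]
  ring

/-- A form of the Sherman–Morrison formula. -/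
theorem dotProduct_inv_add_smul_vecMulVec_mulVec {n R : Type*} [Fintype n] [DecidableEq n]
    [Field R] (K : Matrix n n R) (u : n → R) (s : R) (hK : IsUnit K.det)
    (hs : 1 + s * (u ⬝ᵥ (K⁻¹ *ᵥ u)) ≠ 0) (hKs : IsUnit (K + s • vecMulVec u u).det) :
    u ⬝ᵥ ((K + s • vecMulVec u u)⁻¹ *ᵥ u) =
      (u ⬝ᵥ (K⁻¹ *ᵥ u)) / (1 + s * (u ⬝ᵥ (K⁻¹ *ᵥ u))) := by
  have h : (K + s • vecMulVec u u) *ᵥ (K⁻¹ *ᵥ u) = (1 + s * (u ⬝ᵥ (K⁻¹ *ᵥ u))) • u := by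
    rw [add_mulVec, mulVec_mulVec, mul_nonsing_inv _ hK, one_mulVec, smul_mulVec,
      vecMulVec_mulVec, add_smul, one_smul, mul_smul]
    simp
  have h' := congrArg (fun w => u ⬝ᵥ ((K + s • vecMulVec u u)⁻¹ *ᵥ w)) h
  simp only [mulVec_mulVec _ (K + s • vecMulVec u u)⁻¹ (K + s • vecMulVec u u),
    nonsing_inv_mul _ hKs, one_mulVec, mulVec_smul, dotProduct_smul, smul_eq_mul] at h'
  rw [eq_div_iff hs, mul_comm]
  exact h'.symm

theorem transfer_matrix_deriv_own_eigenvalue_nonneg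
    (M n : ℕ)
    (lam : Fin M → ℝ) (hpos : ∀ i, 0 < lam i)
    (Φ : Matrix (Fin M) (Fin n) ℝ)
    (δ : ℝ) (hδ : 0 ≤ δ)
    (i : Fin M)
    (hK : (Φᵀ * Matrix.diagonal lam * Φ + δ • (1 : Matrix (Fin n) (Fin n) ℝ)).PosDef) :
    let K := Φᵀ * Matrix.diagonal lam * Φ + δ • (1 : Matrix (Fin n) (Fin n) ℝ)
    let c := Φ i ⬝ᵥ (K⁻¹ *ᵥ Φ i)
    HasDerivAt
      (fun t : ℝ =>
        (Matrix.diagonal (Function.update lam i t) * Φ *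
          (Φᵀ * Matrix.diagonal (Function.update lam i t) * Φ
            + δ • (1 : Matrix (Fin n) (Fin n) ℝ))⁻¹ * Φᵀ) i i)
      ((1 - lam i * c) * c) (lam i)
    ∧ 0 ≤ (1 - lam i * c) * c := by
  intro K c
  have hdet : IsUnit K.det := hK.det_pos.ne'.isUnit
  constructor
  · have hden : ∀ᶠ t in nhds (lam i), 1 + (t - lam i) * c ≠ 0 := by
      refine ContinuousAt.eventually_ne (by fun_prop) ?_
      simp
    have hdet_near : ∀ᶠ t in nhds (lam i), (K + (t - lam i) • vecMulVec (Φ i) (Φ i)).det ≠ 0 := by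
      refine ContinuousAt.eventually_ne (Continuous.continuousAt ?_) ?_
      · exact Continuous.matrix_det (by fun_prop)
      · simpa using hdet.ne_zero
    have hderiv : HasDerivAt (fun t : ℝ => t * (c / (1 + (t - lam i) * c)))
        ((1 - lam i * c) * c) (lam i) := by
      have hlin : HasDerivAt (fun t : ℝ => 1 + (t - lam i) * c) (1 * c) (lam i) :=
        (((hasDerivAt_id (lam i)).sub_const (lam i)).mul_const c).const_add 1
      refine ((hasDerivAt_id (lam i)).mul
        ((hasDerivAt_const (lam i) c).div hlin (by simp))).congr_deriv ?_
      simp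
      ring
    refine hderiv.congr_of_eventuallyEq ?_
    filter_upwards [hden, hdet_near] with t ht hdt
    rw [diagonal_mul_mul_mul_transpose_apply_self, transpose_mul_diagonal_update_mul,
      Function.update_self, add_right_comm,
      dotProduct_inv_add_smul_vecMulVec_mulVec K (Φ i) (t - lam i) hdet ht hdt.isUnit]
  · have hquad := dotProduct_transpose_mul_diagonal_mul_add_smul_one_mulVec lam Φ δ (K⁻¹ *ᵥ Φ i)
    rw [mulVec_mulVec, mul_nonsing_inv _ hdet, one_mulVec, dotProduct_comm] at hquad
    have hsum : lam i * c ^ 2 ≤ ∑ j, lam j * (Φ j ⬝ᵥ (K⁻¹ *ᵥ Φ i)) ^ 2 :=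
      Finset.single_le_sum (f := fun j => lam j * (Φ j ⬝ᵥ (K⁻¹ *ᵥ Φ i)) ^ 2)
        (fun j _ => mul_nonneg (hpos j).le (sq_nonneg _)) (Finset.mem_univ i)
    have hridge : 0 ≤ δ * ((K⁻¹ *ᵥ Φ i) ⬝ᵥ (K⁻¹ *ᵥ Φ i)) :=
      mul_nonneg hδ (Finset.sum_nonneg fun j _ => mul_self_nonneg _)
    have hle : lam i * c ^ 2 ≤ c := by
      change c = _ at hquad
      linarith
    linarith [show (1 - lam i * c) * c = c - lam i * c ^ 2 by ring]
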